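/- arXiv:2312.17737 — 2 statements merged into one kernel-verified Lean document; each statement's English description precedes it below -/
import Mathlib

section
/- Let p ∈ (1,n), let Ω ⊂ ℝ^n be a bounded nonempty open set, let A : closure(Ω) → n×n real symmetric matrices be continuous and uniformly positive definite, and let F : ℝ^d → ℝ be continuous and homogeneous of degree p with M_F = max{F(s) : s ∈ 𝕊_p^{d−1}} > 0. Then the functional Φ_{A,F}(u) = ‖u‖_{W_A}^p − ∫_Ω F(u(x)) dx is coercive, in the sense that there exists ε ∈ (0,1) with Φ_{A,F}(u) ≥ ε·‖u‖_{W_A}^p for every smooth compactly supported u : Ω → ℝ^d, if and only if M_F < λ_1(A,p). -/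
open Real MeasureTheory

/-- The quadratic form `⟨M ξ, ξ⟩` of a matrix `M` on `ℝ^n`. -/
noncomputable def quadForm {n : ℕ} (M : Matrix (Fin n) (Fin n) ℝ)
    (ξ : EuclideanSpace ℝ (Fin n)) : ℝ :=
  ∑ i, ∑ j, M i j * ξ j * ξ i

/-- Smooth functions with compact support contained in `Ω`. -/
def SmoothCpt {n : ℕ} {E : Type*} [NormedAddCommGroup E] [NormedSpace ℝ E]
    (Ω : Set (EuclideanSpace ℝ (Fin n))) (u : EuclideanSpace ℝ (Fin n) → E) : Prop :=
  ContDiff ℝ (⊤ : ℕ∞) u ∧ HasCompactSupport u ∧ tsupport u ⊆ Ω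

/-- The anisotropic Sobolev energy `‖u‖_{W_A}^p` of a vector-valued function. -/
noncomputable def WAnorm {n d : ℕ} (p : ℝ) (Ω : Set (EuclideanSpace ℝ (Fin n)))
    (A : EuclideanSpace ℝ (Fin n) → Matrix (Fin n) (Fin n) ℝ)
    (u : EuclideanSpace ℝ (Fin n) → EuclideanSpace ℝ (Fin d)) : ℝ :=
  ∑ j, ∫ x in Ω, (quadForm (A x) (gradient (fun y => u y j) x)) ^ (p / 2)

lemma quadForm_smul' {n : ℕ} (M : Matrix (Fin n) (Fin n) ℝ) (c : ℝ)
    (ξ : EuclideanSpace ℝ (Fin n)) : quadForm M (c • ξ) = c ^ 2 * quadForm M ξ := by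
  simp only [quadForm, Finset.mul_sum, PiLp.smul_apply, smul_eq_mul]
  refine Finset.sum_congr rfl fun i _ => Finset.sum_congr rfl fun j _ => ?_
  ring

lemma quadForm_smul_rpow {n : ℕ} (M : Matrix (Fin n) (Fin n) ℝ) (c p : ℝ)
    (ξ : EuclideanSpace ℝ (Fin n)) (h : 0 ≤ quadForm M ξ) :
    quadForm M (c • ξ) ^ (p / 2) = |c| ^ p * quadForm M ξ ^ (p / 2) := by
  rw [quadForm_smul', Real.mul_rpow (sq_nonneg c) h, ← sq_abs c, ← Real.rpow_natCast,
    ← Real.rpow_mul (abs_nonneg c)]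
  congr 2
  push_cast
  ring

lemma gradient_comp_real {n : ℕ} (u : EuclideanSpace ℝ (Fin n) → ℝ) (g : ℝ → ℝ) (g' : ℝ)
    (x : EuclideanSpace ℝ (Fin n)) (hu : DifferentiableAt ℝ u x)
    (hg : HasDerivAt g g' (u x)) :
    gradient (fun y => g (u y)) x = g' • gradient u x := by
  have h := hg.comp_hasFDerivAt x hu.hasFDerivAt
  have h2 : fderiv ℝ (fun y => g (u y)) x = g' • fderiv ℝ u x := h.fderiv
  simp only [gradient, h2]
  simp

lemma SmoothCpt.comp_zero {n : ℕ} {E E' : Type*} [NormedAddCommGroup E] [NormedSpace ℝ E]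
    [NormedAddCommGroup E'] [NormedSpace ℝ E']
    {Ω : Set (EuclideanSpace ℝ (Fin n))} {u : EuclideanSpace ℝ (Fin n) → E}
    (hu : SmoothCpt Ω u) (g : E → E') (hg : ContDiff ℝ (⊤ : ℕ∞) g) (g0 : g 0 = 0) :
    SmoothCpt Ω (fun x => g (u x)) :=
  ⟨hg.comp hu.1, hu.2.1.comp_left g0, (tsupport_comp_subset g0 u).trans hu.2.2⟩

lemma integrableOn_of_continuous {n : ℕ} {Ω : Set (EuclideanSpace ℝ (Fin n))}
    (hΩb : Bornology.IsBounded Ω) (f : EuclideanSpace ℝ (Fin n) → ℝ)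
    (hf : ContinuousOn f (closure Ω)) : IntegrableOn f Ω :=
  (hf.integrableOn_compact hΩb.isCompact_closure).mono_set subset_closure

lemma continuousOn_energy {n : ℕ} {p : ℝ} (hp : 0 < p) {Ω : Set (EuclideanSpace ℝ (Fin n))}
    {A : EuclideanSpace ℝ (Fin n) → Matrix (Fin n) (Fin n) ℝ}
    (hAc : ContinuousOn A (closure Ω)) {u : EuclideanSpace ℝ (Fin n) → ℝ}
    (hu : ContDiff ℝ (⊤ : ℕ∞) u) :
    ContinuousOn (fun x => quadForm (A x) (gradient u x) ^ (p / 2)) (closure Ω) := by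
  have hg : Continuous (gradient u) := by
    have : Continuous (fderiv ℝ u) := hu.continuous_fderiv (by simp)
    exact (LinearIsometryEquiv.continuous _).comp this
  refine ContinuousOn.rpow_const ?_ (fun x _ => Or.inr (by positivity))
  unfold quadForm
  refine continuousOn_finsetSum _ fun i _ => continuousOn_finsetSum _ fun j _ => ?_
  have h1 : ContinuousOn (fun x => A x i j) (closure Ω) :=
    (continuous_apply_apply i j).comp_continuousOn hAc
  have h2 : ∀ k, Continuous (fun x => gradient u x k) := fun k => by fun_prop
  exact (h1.mul (h2 j).continuousOn).mul (h2 i).continuousOn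

lemma F_le_mul {d : ℕ} {p : ℝ} (hp : 0 < p) (F : EuclideanSpace ℝ (Fin d) → ℝ)
    (hFhom : ∀ ϱ : ℝ, 0 < ϱ → ∀ s : EuclideanSpace ℝ (Fin d), F (ϱ • s) = ϱ ^ p * F s)
    (MF : ℝ) (hle : ∀ s : EuclideanSpace ℝ (Fin d), (∑ i, |s i| ^ p) = 1 → F s ≤ MF)
    (s : EuclideanSpace ℝ (Fin d)) : F s ≤ MF * ∑ i, |s i| ^ p := by
  have hN : 0 ≤ ∑ i, |s i| ^ p := Finset.sum_nonneg fun i _ => by positivity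
  rcases hN.eq_or_lt with h | h
  · have h0 : s = 0 := by
      ext i
      have := (Finset.sum_eq_zero_iff_of_nonneg (fun i _ => by positivity)).1 h.symm i
        (Finset.mem_univ i)
      rw [Real.rpow_eq_zero (abs_nonneg _) hp.ne'] at this
      simpa using this
    have h1 := hFhom 2 (by norm_num) 0
    rw [smul_zero] at h1
    have h2 : (1 : ℝ) < 2 ^ p := Real.one_lt_rpow (by norm_num) hp
    have h3 : F 0 = 0 := by
      have : (2 ^ p - 1) * F 0 = 0 := by linarith
      rcases mul_eq_zero.1 this with h | h
      · linarith
      · exact h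
    rw [← h, h0, h3]; simp
  · set N := ∑ i, |s i| ^ p with hNdef
    have hr : 0 < N ^ (1 / p) := by positivity
    have hrp : (N ^ (1 / p)) ^ p = N := by
      rw [← Real.rpow_mul hN, one_div_mul_cancel hp.ne', Real.rpow_one]
    have h1 := hFhom (N ^ (1 / p)) hr ((N ^ (1 / p))⁻¹ • s)
    rw [smul_inv_smul₀ hr.ne', hrp] at h1
    rw [h1, mul_comm]
    refine mul_le_mul_of_nonneg_right (hle _ ?_) hN
    have : ∀ i, |((N ^ (1 / p))⁻¹ • s) i| ^ p = N⁻¹ * |s i| ^ p := by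
      intro i
      rw [PiLp.smul_apply, smul_eq_mul, abs_mul, abs_of_pos (inv_pos.2 hr),
        Real.mul_rpow (by positivity) (abs_nonneg _), Real.inv_rpow hr.le, hrp]
    simp_rw [this]
    rw [← Finset.mul_sum, ← hNdef, inv_mul_cancel₀ h.ne']

lemma isCompact_pSphere {d : ℕ} {p : ℝ} (hp : 0 < p) :
    IsCompact {s : EuclideanSpace ℝ (Fin d) | (∑ i, |s i| ^ p) = 1} := by
  refine Metric.isCompact_of_isClosed_isBounded ?_ ?_
  · refine isClosed_eq ?_ continuous_const
    refine continuous_finsetSum _ fun i _ => ?_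
    exact Continuous.rpow_const (by fun_prop) (fun _ => Or.inr hp.le)
  · refine isBounded_iff_forall_norm_le.2 ⟨√d, fun s hs => ?_⟩
    rw [EuclideanSpace.norm_eq]
    refine Real.sqrt_le_sqrt ?_
    have : ∀ i, ‖s i‖ ^ 2 ≤ 1 := by
      intro i
      have h1 : |s i| ^ p ≤ 1 := by
        rw [← (hs : (∑ i, |s i| ^ p) = 1)]
        exact Finset.single_le_sum (f := fun i => |s i| ^ p) (fun i _ => by positivity)
          (Finset.mem_univ i)
      have h2 : |s i| ≤ 1 := by
        by_contra! hh
        exact absurd (Real.one_lt_rpow hh hp) (not_lt.2 h1)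
      rw [Real.norm_eq_abs]
      exact pow_le_one₀ (abs_nonneg _) h2
    calc ∑ i, ‖s i‖ ^ 2 ≤ ∑ _i : Fin d, (1 : ℝ) := Finset.sum_le_sum fun i _ => this i
      _ = d := by simp

/-- Smooth approximation of the absolute value. -/
noncomputable def sAbs (δ t : ℝ) : ℝ := √(t ^ 2 + δ ^ 2) - δ

lemma sAbs_contDiff {δ : ℝ} (hδ : 0 < δ) : ContDiff ℝ (⊤ : ℕ∞) (sAbs δ) := by
  unfold sAbs
  refine ContDiff.sub (ContDiff.sqrt (by fun_prop) fun x => by positivity) contDiff_const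

lemma sAbs_zero {δ : ℝ} (hδ : 0 < δ) : sAbs δ 0 = 0 := by
  simp [sAbs, Real.sqrt_sq hδ.le]

lemma sAbs_nonneg {δ : ℝ} (hδ : 0 < δ) (t : ℝ) : 0 ≤ sAbs δ t := by
  have : δ ≤ √(t ^ 2 + δ ^ 2) := Real.le_sqrt_of_sq_le (by nlinarith [sq_nonneg t])
  unfold sAbs; linarith

lemma sAbs_le {δ : ℝ} (hδ : 0 < δ) (t : ℝ) : sAbs δ t ≤ |t| := by
  have : √(t ^ 2 + δ ^ 2) ≤ |t| + δ := by
    refine Real.sqrt_le_iff.2 ⟨by positivity, ?_⟩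
    nlinarith [sq_abs t, abs_nonneg t, mul_nonneg (abs_nonneg t) hδ.le]
  unfold sAbs; linarith

lemma sAbs_deriv {δ : ℝ} (hδ : 0 < δ) (t : ℝ) :
    ∃ c, HasDerivAt (sAbs δ) c t ∧ |c| ≤ 1 := by
  have hpos : 0 < t ^ 2 + δ ^ 2 := by positivity
  have h1 : HasDerivAt (fun t : ℝ => t ^ 2 + δ ^ 2) (2 * t) t := by
    simpa using ((hasDerivAt_id t).pow 2).add_const (δ ^ 2)
  refine ⟨_, (h1.sqrt hpos.ne').sub_const δ, ?_⟩
  have h2 : |t| ≤ √(t ^ 2 + δ ^ 2) := Real.abs_le_sqrt (by nlinarith [sq_nonneg δ])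
  have h3 : 0 < √(t ^ 2 + δ ^ 2) := Real.sqrt_pos.2 hpos
  rw [abs_div, abs_mul, abs_mul, abs_of_pos h3, abs_two, div_le_one (by positivity)]
  linarith

lemma tendsto_sAbs {δ : ℕ → ℝ} (hδ : Filter.Tendsto δ Filter.atTop (nhds 0)) (t : ℝ) :
    Filter.Tendsto (fun k => sAbs (δ k) t) Filter.atTop (nhds |t|) := by
  have : Continuous (fun e => sAbs e t) := by unfold sAbs; fun_prop
  have h := (this.tendsto 0).comp hδ
  simpa [sAbs, Real.sqrt_sq_eq_abs, Function.comp_def] using h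

/-- The functional `Φ_{A,F}(u) = ‖u‖_{W_A}^p - ∫_Ω F(u)` is coercive
if and only if `M_F < λ_1(A,p)`. -/
theorem coercive_iff_MF_lt_lambda1 {n d : ℕ} (p : ℝ) (hp1 : 1 < p) (hpn : p < n)
    (Ω : Set (EuclideanSpace ℝ (Fin n))) (hΩo : IsOpen Ω)
    (hΩb : Bornology.IsBounded Ω) (hΩne : Ω.Nonempty)
    (A : EuclideanSpace ℝ (Fin n) → Matrix (Fin n) (Fin n) ℝ)
    (hAc : ContinuousOn A (closure Ω))
    (hAsymm : ∀ x ∈ closure Ω, (A x).IsSymm)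
    (τ : ℝ) (hτ : 0 < τ)
    (hApos : ∀ x ∈ closure Ω, ∀ ξ : EuclideanSpace ℝ (Fin n),
      τ * ‖ξ‖ ^ 2 ≤ quadForm (A x) ξ)
    (F : EuclideanSpace ℝ (Fin d) → ℝ) (hFc : Continuous F)
    (hFhom : ∀ ϱ : ℝ, 0 < ϱ → ∀ s : EuclideanSpace ℝ (Fin d), F (ϱ • s) = ϱ ^ p * F s)
    (MF : ℝ)
    (hMF : MF = sSup (F '' {s : EuclideanSpace ℝ (Fin d) | (∑ i, |s i| ^ p) = 1}))
    (hMFpos : 0 < MF) :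
    (∃ ε ∈ Set.Ioo (0 : ℝ) 1,
        ∀ u : EuclideanSpace ℝ (Fin n) → EuclideanSpace ℝ (Fin d), SmoothCpt Ω u →
          ε * WAnorm p Ω A u ≤ WAnorm p Ω A u - ∫ x in Ω, F (u x))
      ↔ MF < sInf {r : ℝ | ∃ u : EuclideanSpace ℝ (Fin n) → ℝ,
          SmoothCpt Ω u ∧ (∫ x in Ω, |u x| ^ p) = 1 ∧
          r = ∫ x in Ω, (quadForm (A x) (gradient u x)) ^ (p / 2)} := by
  have hp : 0 < p := by linarith
  have hQ : ∀ x ∈ closure Ω, ∀ ξ, 0 ≤ quadForm (A x) ξ := fun x hx ξ =>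
    le_trans (by positivity) (hApos x hx ξ)
  have hQΩ : ∀ x ∈ Ω, ∀ ξ, 0 ≤ quadForm (A x) ξ := fun x hx ξ => hQ x (subset_closure hx) ξ
  have hms : MeasurableSet Ω := hΩo.measurableSet
  have hSc := isCompact_pSphere (d := d) hp
  have hSne : (F '' {s : EuclideanSpace ℝ (Fin d) | (∑ i, |s i| ^ p) = 1}).Nonempty := by
    by_contra h
    rw [Set.not_nonempty_iff_eq_empty] at h
    rw [h, Real.sSup_empty] at hMF
    exact hMFpos.ne' hMF
  have hcomp := hSc.image hFc
  have hMle : ∀ s : EuclideanSpace ℝ (Fin d), (∑ i, |s i| ^ p) = 1 → F s ≤ MF := fun s hs => by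
    rw [hMF]
    exact le_csSup hcomp.bddAbove ⟨s, hs, rfl⟩
  obtain ⟨s0, hs0, hFs0⟩ := hcomp.sSup_mem hSne
  rw [← hMF] at hFs0
  have hs0' : (∑ i, |s0 i| ^ p) = 1 := hs0
  set S : Set ℝ := {r : ℝ | ∃ u : EuclideanSpace ℝ (Fin n) → ℝ,
          SmoothCpt Ω u ∧ (∫ x in Ω, |u x| ^ p) = 1 ∧
          r = ∫ x in Ω, (quadForm (A x) (gradient u x)) ^ (p / 2)} with hS
  have hEnn : ∀ u : EuclideanSpace ℝ (Fin n) → ℝ,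
      0 ≤ ∫ x in Ω, (quadForm (A x) (gradient u x)) ^ (p / 2) := fun u =>
    setIntegral_nonneg hms fun x hx => Real.rpow_nonneg (hQΩ x hx _) _
  have hSbdd : BddBelow S := ⟨0, by rintro r ⟨u, -, -, rfl⟩; exact hEnn u⟩
  have hEsmul : ∀ (c : ℝ) (u : EuclideanSpace ℝ (Fin n) → ℝ), SmoothCpt Ω u →
      (∫ x in Ω, (quadForm (A x) (gradient (fun y => c * u y) x)) ^ (p / 2))
        = |c| ^ p * ∫ x in Ω, (quadForm (A x) (gradient u x)) ^ (p / 2) := by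
    intro c u hu
    rw [← integral_const_mul]
    refine setIntegral_congr_fun hms fun x hx => ?_
    have hd : DifferentiableAt ℝ u x := (hu.1.differentiable (by simp)) x
    have hg : HasDerivAt (fun t : ℝ => c * t) c (u x) := by
      simpa using (hasDerivAt_id (u x)).const_mul c
    have := gradient_comp_real u (fun t => c * t) c x hd hg
    simp only [this]
    exact quadForm_smul_rpow _ _ _ _ (hQΩ x hx _)
  have hLsmul : ∀ (c : ℝ) (u : EuclideanSpace ℝ (Fin n) → ℝ),
      (∫ x in Ω, |c * u x| ^ p) = |c| ^ p * ∫ x in Ω, |u x| ^ p := by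
    intro c u
    rw [← integral_const_mul]
    refine integral_congr_ae (Filter.Eventually.of_forall fun x => ?_)
    simp only [abs_mul]
    exact Real.mul_rpow (abs_nonneg _) (abs_nonneg _)
  have hLint : ∀ u : EuclideanSpace ℝ (Fin n) → ℝ, Continuous u →
      IntegrableOn (fun x => |u x| ^ p) Ω := fun u hu =>
    integrableOn_of_continuous hΩb _
      (Continuous.rpow_const (by fun_prop) (fun _ => Or.inr hp.le)).continuousOn
  have hnorm : ∀ u : EuclideanSpace ℝ (Fin n) → ℝ, SmoothCpt Ω u →
      0 < (∫ x in Ω, |u x| ^ p) →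
      (∫ x in Ω, |u x| ^ p)⁻¹ * (∫ x in Ω, (quadForm (A x) (gradient u x)) ^ (p / 2)) ∈ S := by
    intro u hu h
    set N := ∫ x in Ω, |u x| ^ p with hN
    have hcp : |N ^ (-(1 / p))| ^ p = N⁻¹ := by
      rw [abs_of_nonneg (by positivity), ← Real.rpow_mul h.le, neg_mul,
        one_div_mul_cancel hp.ne', Real.rpow_neg_one]
    refine ⟨fun x => N ^ (-(1 / p)) * u x,
      hu.comp_zero (fun t => N ^ (-(1 / p)) * t) (by fun_prop) (by simp), ?_, ?_⟩
    · rw [hLsmul, hcp, ← hN, inv_mul_cancel₀ h.ne']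
    · rw [hEsmul _ _ hu, hcp]
  constructor
  · rintro ⟨ε, ⟨hε0, hε1⟩, hco⟩
    have hSne' : S.Nonempty := by
      obtain ⟨x0, hx0⟩ := hΩne
      obtain ⟨f, hf1, hf2, hf3, hf4, hf5⟩ :=
        exists_contDiff_tsupport_subset (n := ⊤) (hΩo.mem_nhds hx0)
      refine ⟨_, hnorm f ⟨hf3, hf2, hf1⟩ ?_⟩
      rw [setIntegral_pos_iff_support_of_nonneg_ae
        (Filter.Eventually.of_forall fun x => by positivity) (hLint f hf3.continuous)]
      refine IsOpen.measure_pos volume ?_ ⟨x0, ?_, hx0⟩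
      · refine IsOpen.inter ?_ hΩo
        exact (Continuous.rpow_const (by have := hf3.continuous; fun_prop)
          (fun _ => Or.inr hp.le)).isOpen_support
      · simp [hf5]
    have key : ∀ u : EuclideanSpace ℝ (Fin n) → ℝ, SmoothCpt Ω u →
        MF * (∫ x in Ω, |u x| ^ p) ≤
          (1 - ε) * ∫ x in Ω, (quadForm (A x) (gradient u x)) ^ (p / 2) := by
      intro u hu
      have hδ : ∀ k : ℕ, 0 < 1 / ((k : ℝ) + 1) := fun k => by positivity
      have hstep : ∀ k : ℕ, MF * (∫ x in Ω, |sAbs (1 / ((k : ℝ) + 1)) (u x)| ^ p) ≤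
          (1 - ε) * ∫ x in Ω, (quadForm (A x) (gradient u x)) ^ (p / 2) := by
        intro k
        set δ := 1 / ((k : ℝ) + 1)
        have hv : SmoothCpt Ω (fun x => sAbs δ (u x)) :=
          hu.comp_zero _ (sAbs_contDiff (hδ k)) (sAbs_zero (hδ k))
        have hw : SmoothCpt Ω (fun x => sAbs δ (u x) • s0) :=
          hv.comp_zero (fun t : ℝ => t • s0) (by fun_prop) (by simp)
        have h1 := hco _ hw
        have hW : WAnorm p Ω A (fun x => sAbs δ (u x) • s0) =
            ∫ x in Ω, (quadForm (A x) (gradient (fun x => sAbs δ (u x)) x)) ^ (p / 2) := by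
          unfold WAnorm
          have : ∀ j, (fun y => (sAbs δ (u y) • s0) j) = fun y => s0 j * sAbs δ (u y) := by
            intro j; ext y; simp [mul_comm]
          simp_rw [this]
          simp_rw [fun j => hEsmul (s0 j) _ hv]
          rw [← Finset.sum_mul, hs0', one_mul]
        have hFv : (∫ x in Ω, F (sAbs δ (u x) • s0)) =
            MF * ∫ x in Ω, |sAbs δ (u x)| ^ p := by
          rw [← integral_const_mul]
          refine integral_congr_ae (Filter.Eventually.of_forall fun x => ?_)
          have hnn : 0 ≤ sAbs δ (u x) := sAbs_nonneg (hδ k) (u x)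
          simp only [abs_of_nonneg hnn]
          rcases hnn.eq_or_lt with h | h
          · rw [← h, zero_smul, Real.zero_rpow hp.ne', mul_zero]
            have h1 := hFhom 2 (by norm_num) 0
            rw [smul_zero] at h1
            have h2 : (1 : ℝ) < 2 ^ p := Real.one_lt_rpow (by norm_num) hp
            have : (2 ^ p - 1) * F 0 = 0 := by linarith
            rcases mul_eq_zero.1 this with h | h
            · linarith
            · exact h
          · rw [hFhom _ h, hFs0, mul_comm]
        rw [hW, hFv] at h1
        have hEle : (∫ x in Ω, (quadForm (A x) (gradient (fun x => sAbs δ (u x)) x)) ^ (p / 2))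
            ≤ ∫ x in Ω, (quadForm (A x) (gradient u x)) ^ (p / 2) := by
          refine setIntegral_mono_on
            (integrableOn_of_continuous hΩb _ (continuousOn_energy hp hAc hv.1))
            (integrableOn_of_continuous hΩb _ (continuousOn_energy hp hAc hu.1)) hms ?_
          intro x hx
          obtain ⟨c, hc, hc1⟩ := sAbs_deriv (hδ k) (u x)
          have hd : DifferentiableAt ℝ u x := (hu.1.differentiable (by simp)) x
          rw [gradient_comp_real u _ c x hd hc, quadForm_smul_rpow _ _ _ _ (hQΩ x hx _)]
          exact mul_le_of_le_one_left (Real.rpow_nonneg (hQΩ x hx _) _)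
            (Real.rpow_le_one (abs_nonneg _) hc1 hp.le)
        have h3 := mul_le_mul_of_nonneg_left hEle (by linarith : 0 ≤ 1 - ε)
        linarith
      have hlim : Filter.Tendsto
          (fun k : ℕ => ∫ x in Ω, |sAbs (1 / ((k : ℝ) + 1)) (u x)| ^ p) Filter.atTop
          (nhds (∫ x in Ω, |u x| ^ p)) := by
        refine tendsto_integral_of_dominated_convergence (fun x => |u x| ^ p) ?_
          (hLint u hu.1.continuous) ?_ ?_
        · intro k
          exact (hLint _ ((sAbs_contDiff (hδ k)).continuous.comp
            hu.1.continuous)).aestronglyMeasurable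
        · intro k
          refine Filter.Eventually.of_forall fun x => ?_
          rw [Real.norm_of_nonneg (by positivity), abs_of_nonneg (sAbs_nonneg (hδ k) _)]
          exact Real.rpow_le_rpow (sAbs_nonneg (hδ k) _) (sAbs_le (hδ k) _) hp.le
        · refine Filter.Eventually.of_forall fun x => ?_
          have h := (tendsto_sAbs tendsto_one_div_add_atTop_nhds_zero_nat (u x)).abs
          rw [abs_abs] at h
          exact h.rpow_const (Or.inr hp.le)
      exact le_of_tendsto (hlim.const_mul MF) (Filter.Eventually.of_forall hstep)
    have h1 : MF / (1 - ε) ≤ sInf S := by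
      refine le_csInf hSne' ?_
      rintro r ⟨u, hu, hu1, rfl⟩
      have := key u hu
      rw [hu1, mul_one] at this
      rw [div_le_iff₀ (by linarith)]
      linarith
    refine lt_of_lt_of_le ?_ h1
    rw [lt_div_iff₀ (by linarith)]
    nlinarith
  · intro hlt
    set L := sInf S with hL
    have hL0 : 0 < L := hMFpos.trans hlt
    have hray : ∀ u : EuclideanSpace ℝ (Fin n) → ℝ, SmoothCpt Ω u →
        L * (∫ x in Ω, |u x| ^ p) ≤ ∫ x in Ω, (quadForm (A x) (gradient u x)) ^ (p / 2) := by
      intro u hu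
      have hN : 0 ≤ ∫ x in Ω, |u x| ^ p := integral_nonneg fun x => by positivity
      rcases hN.eq_or_lt with h | h
      · rw [← h, mul_zero]; exact hEnn u
      · have := csInf_le hSbdd (hnorm u hu h)
        rw [← hL, inv_mul_eq_div, le_div_iff₀ h] at this
        exact this
    have hq1 : MF / L < 1 := (div_lt_one hL0).2 hlt
    have hq0 : 0 < MF / L := by positivity
    refine ⟨1 - MF / L, ⟨by linarith, by linarith⟩, fun u hu => ?_⟩
    have huj : ∀ j, SmoothCpt Ω (fun x => u x j) := fun j =>
      hu.comp_zero (fun s : EuclideanSpace ℝ (Fin d) => s j) (by fun_prop) (by simp)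
    have h1 : (∫ x in Ω, F (u x)) ≤ ∫ x in Ω, MF * ∑ j, |u x j| ^ p := by
      refine setIntegral_mono_on ?_ ?_ hms fun x _ => F_le_mul hp F hFhom MF hMle (u x)
      · exact integrableOn_of_continuous hΩb _ (hFc.comp hu.1.continuous).continuousOn
      · exact (integrable_finsetSum _ fun j _ => hLint _ (huj j).1.continuous).const_mul MF
    rw [integral_const_mul, integral_finsetSum _ fun j _ => hLint _ (huj j).1.continuous] at h1
    have h2 : L * ∑ j, (∫ x in Ω, |u x j| ^ p) ≤ WAnorm p Ω A u := by
      rw [Finset.mul_sum]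
      exact Finset.sum_le_sum fun j _ => hray _ (huj j)
    have h3 : MF * ∑ j, (∫ x in Ω, |u x j| ^ p) ≤ MF / L * WAnorm p Ω A u := by
      have := mul_le_mul_of_nonneg_left h2 hq0.le
      rwa [← mul_assoc, div_mul_cancel₀ _ hL0.ne'] at this
    linarith
end

section
/- Let p ∈ (1,n), let c > 0, let U(x) = c·(1 + |x|^{p/(p−1)})^{−(n−p)/p} and U_ε(x) = ε^{−(n−p)/p}·U(x/ε) for ε > 0, let η be a smooth compactly supported function on ℝ^n with η ≡ 1 on a neighborhood of the origin, and set w_ε = η·U_ε. Then for every γ > p there exist constants C > 0 and ε₀ > 0 such that for all ε ∈ (0, ε₀): ∫_{ℝ^n} |y|^γ·|∇w_ε(y)|^p dy ≤ C·ε^γ if γ < (n−p)/(p−1); ∫_{ℝ^n} |y|^γ·|∇w_ε(y)|^p dy ≤ C·ε^γ·|log ε| if γ = (n−p)/(p−1); and ∫_{ℝ^n} |y|^γ·|∇w_ε(y)|^p dy ≤ C·ε^{(n−p)/(p−1)} if γ > (n−p)/(p−1). -/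
open Real MeasureTheory

/-- The truncated Sobolev bubble `w_ε = η · U_ε`, where
`U(x) = c (1 + |x|^{p/(p-1)})^{-(n-p)/p}` and `U_ε(x) = ε^{-(n-p)/p} U(x/ε)`. -/
noncomputable def bubbleW {n : ℕ} (p c : ℝ) (η : EuclideanSpace ℝ (Fin n) → ℝ)
    (ε : ℝ) (x : EuclideanSpace ℝ (Fin n)) : ℝ :=
  η x * (ε ^ (-(((n : ℝ) - p) / p)) *
    (c * (1 + ‖ε⁻¹ • x‖ ^ (p / (p - 1))) ^ (-(((n : ℝ) - p) / p))))


lemma bw_deriv {n : ℕ} (p : ℝ) (hp1 : 1 < p) (hpn : p < n)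
    (c : ℝ) (hc : 0 < c) (η : EuclideanSpace ℝ (Fin n) → ℝ) (hη : ContDiff ℝ (⊤ : ℕ∞) η)
    (ε : ℝ) (hε : 0 < ε) (y : EuclideanSpace ℝ (Fin n)) (m s t : ℝ)
    (hm : m = ((n : ℝ) - p) / p) (hs : s = p / (p - 1)) (ht : t = ‖y‖ / ε) :
    ‖gradient (bubbleW p c η ε) y‖ ≤
      |η y| * (ε ^ (-m) * (c * (m * (1 + t ^ s) ^ (-m - 1) * (s * t ^ (s - 1) * ε⁻¹)))) +
        (ε ^ (-m) * (c * (1 + t ^ s) ^ (-m))) * ‖fderiv ℝ η y‖ := by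
  have hs1 : 1 < s := by
    rw [hs, lt_div_iff₀ (by linarith)]; linarith
  have hm0 : 0 < m := by rw [hm]; apply div_pos <;> linarith
  have ht0 : 0 ≤ t := by rw [ht]; positivity
  have htn : ‖ε⁻¹ • y‖ = t := by
    rw [norm_smul, Real.norm_of_nonneg (by positivity), ht]; field_simp
  have hpos : (1 + t ^ s) ≠ 0 := by positivity
  obtain ⟨D, hD, hDn⟩ : ∃ D : EuclideanSpace ℝ (Fin n) →L[ℝ] ℝ,
      HasFDerivAt (fun x : EuclideanSpace ℝ (Fin n) => ‖ε⁻¹ • x‖ ^ s) D y ∧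
      ‖D‖ ≤ s * t ^ (s - 1) * ε⁻¹ := by
    have h1 := hasFDerivAt_norm_rpow (ε⁻¹ • y) hs1
    have h2 : HasFDerivAt (fun x : EuclideanSpace ℝ (Fin n) => ε⁻¹ • x)
      (ε⁻¹ • ContinuousLinearMap.id ℝ (EuclideanSpace ℝ (Fin n))) y :=
      (hasFDerivAt_id (𝕜 := ℝ) y).const_smul ε⁻¹
    refine ⟨_, h1.comp y h2, ?_⟩
    refine (ContinuousLinearMap.opNorm_comp_le _ _).trans ?_
    have h3 : ‖(s * ‖ε⁻¹ • y‖ ^ (s - 2)) • (innerSL ℝ) (ε⁻¹ • y)‖ ≤ s * t ^ (s - 1) := by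
      rw [norm_smul, innerSL_apply_norm, htn, Real.norm_of_nonneg (by positivity)]
      rcases ht0.eq_or_lt with h | h
      · rw [← h]; simp; positivity
      · rw [mul_assoc, ← Real.rpow_add_one h.ne']; apply le_of_eq; ring_nf
    have h4 : ‖ε⁻¹ • ContinuousLinearMap.id ℝ (EuclideanSpace ℝ (Fin n))‖ ≤ ε⁻¹ := by
      rw [norm_smul, Real.norm_of_nonneg (by positivity)]
      exact mul_le_of_le_one_right (by positivity) ContinuousLinearMap.norm_id_le
    gcongr
  have hU := (((hD.const_add 1).rpow_const (p := -m) (by left; rwa [htn])).const_mul c).const_mul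
    (ε ^ (-m))
  have hηd : HasFDerivAt η (fderiv ℝ η y) y := (hη.differentiable (by simp) y).hasFDerivAt
  have hw := hηd.mul hU
  have hw' : bubbleW p c η ε =
      (η * fun y => ε ^ (-m) * (c * (1 + ‖ε⁻¹ • y‖ ^ s) ^ (-m))) := by
    ext x; simp only [bubbleW, hm, hs, Pi.mul_apply]
  rw [gradient, LinearIsometryEquiv.norm_map, hw', hw.fderiv]
  refine (norm_add_le _ _).trans ?_
  simp only [norm_smul, htn, Real.norm_eq_abs]
  have e1 : |ε ^ (-m)| = ε ^ (-m) := abs_of_nonneg (by positivity)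
  have e2 : |(1 + t ^ s) ^ (-m - 1)| = (1 + t ^ s) ^ (-m - 1) := abs_of_nonneg (by positivity)
  have e3 : |(1 + t ^ s) ^ (-m)| = (1 + t ^ s) ^ (-m) := abs_of_nonneg (by positivity)
  simp only [abs_mul, e1, e2, e3, abs_of_pos hc, abs_neg, abs_of_pos hm0]
  gcongr

lemma bw_bound {n : ℕ} (p : ℝ) (hp1 : 1 < p) (hpn : p < n)
    (c : ℝ) (hc : 0 < c) (η : EuclideanSpace ℝ (Fin n) → ℝ) (hη : ContDiff ℝ (⊤ : ℕ∞) η)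
    (hηcpt : HasCompactSupport η) :
    ∃ B > 0, ∃ R ≥ 3, ∀ ε : ℝ, 0 < ε → ε ≤ 1 → ∀ y : EuclideanSpace ℝ (Fin n),
      (R < ‖y‖ → gradient (bubbleW p c η ε) y = 0) ∧
      (‖y‖ ≤ ε → ‖gradient (bubbleW p c η ε) y‖ ^ p ≤ B * ε ^ (-(n : ℝ))) ∧
      (ε < ‖y‖ → ‖y‖ ≤ R → ‖gradient (bubbleW p c η ε) y‖ ^ p ≤
        B * (ε ^ (((n : ℝ) - p) / (p - 1)) * ‖y‖ ^ (-(((n : ℝ) - p) / (p - 1)) - n))) := by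
  obtain ⟨M1, hM1⟩ := hη.continuous.bounded_above_of_compact_support hηcpt
  obtain ⟨M2, hM2⟩ := (hη.continuous_fderiv (by simp)).bounded_above_of_compact_support
    (hηcpt.fderiv ℝ)
  obtain ⟨R0, hR0⟩ := hηcpt.isBounded.subset_closedBall (0 : EuclideanSpace ℝ (Fin n))
  set M := max (max M1 M2) 1
  have hM0 : 0 < M := lt_of_lt_of_le one_pos (le_max_right _ _)
  set R := max R0 3
  have hR3 : 3 ≤ R := le_max_right _ _
  set m := ((n : ℝ) - p) / p with hm
  set s := p / (p - 1) with hs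
  have hp0 : 0 < p := by linarith
  have hp10 : 0 < p - 1 := by linarith
  have hs1 : 1 < s := by
    rw [hs, lt_div_iff₀ (by linarith)]; linarith
  have hm0 : 0 < m := by rw [hm]; apply div_pos <;> linarith
  set A := M * c * (R + m * s)
  have hA : 0 < A := by positivity
  refine ⟨A ^ p, by positivity, R, hR3, fun ε hε hε1 y => ?_⟩
  have key := bw_deriv p hp1 hpn c hc η hη ε hε y m s (‖y‖ / ε) hm hs rfl
  set t := ‖y‖ / ε with ht
  have ht0 : 0 ≤ t := by positivity
  refine ⟨fun hy => ?_, ?_⟩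
  · have hns : y ∉ tsupport η := fun h => by
      have := hR0 h
      rw [mem_closedBall_zero_iff] at this
      exact absurd (this.trans (le_max_left _ _)) (not_le.2 hy)
    rw [image_eq_zero_of_notMem_tsupport hns,
      image_eq_zero_of_notMem_tsupport (fun h => hns (tsupport_fderiv_subset ℝ h))] at key
    simpa using key
  have hb1 : |η y| ≤ M := (hM1 y).trans ((le_max_left _ _).trans (le_max_left _ _))
  have hb2 : ‖fderiv ℝ η y‖ ≤ M := (hM2 y).trans ((le_max_right _ _).trans (le_max_left _ _))
  have hεm : ε ^ (-m) = ε ^ (-m - 1) * ε := by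
    rw [← Real.rpow_add_one hε.ne']; ring_nf
  have key2 : ‖gradient (bubbleW p c η ε) y‖ ≤ M * c * ε ^ (-m - 1) *
      (m * s * ((1 + t ^ s) ^ (-m - 1) * t ^ (s - 1)) + ε * (1 + t ^ s) ^ (-m)) := by
    calc _ ≤ _ := key
      _ ≤ M * (ε ^ (-m) * (c * (m * (1 + t ^ s) ^ (-m - 1) * (s * t ^ (s - 1) * ε⁻¹)))) +
        (ε ^ (-m) * (c * (1 + t ^ s) ^ (-m))) * M := by gcongr
      _ = _ := by rw [hεm]; field_simp
  have hmp : (-m - 1) * p = -n := by rw [hm]; field_simp; ring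
  constructor
  · intro hy
    have ht1 : t ≤ 1 := by rw [ht, div_le_one hε]; exact hy
    have : ‖gradient (bubbleW p c η ε) y‖ ≤ A * ε ^ (-m - 1) := by
      calc _ ≤ _ := key2
        _ ≤ M * c * ε ^ (-m - 1) * (m * s * (1 * 1) + R * 1) := by
          have : 1 ≤ 1 + t ^ s := by linarith [Real.rpow_nonneg ht0 s]
          gcongr
          · exact Real.rpow_le_one_of_one_le_of_nonpos this (by linarith)
          · exact Real.rpow_le_one ht0 ht1 (by linarith)
          · linarith
          · exact Real.rpow_le_one_of_one_le_of_nonpos this (by linarith)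
        _ = _ := by simp only [A]; ring
    calc _ ≤ (A * ε ^ (-m - 1)) ^ p := by gcongr
      _ = _ := by rw [Real.mul_rpow hA.le (by positivity), ← Real.rpow_mul hε.le, hmp]
  · intro hy hyR
    have hy0 : 0 < ‖y‖ := hε.trans hy
    have ht1 : 0 < t := by positivity
    have hle : t ^ s ≤ 1 + t ^ s := by linarith
    have hq : ‖gradient (bubbleW p c η ε) y‖ ≤ A * (ε ^ (-m - 1) * t ^ (-(s * m) - 1)) := by
      calc _ ≤ _ := key2
        _ ≤ M * c * ε ^ (-m - 1) * (m * s * ((t ^ s) ^ (-m - 1) * t ^ (s - 1)) +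
            ε * (t ^ s) ^ (-m)) := by
          have := Real.rpow_le_rpow_of_nonpos (z := -m - 1) (Real.rpow_pos_of_pos ht1 s) hle
            (by linarith)
          have := Real.rpow_le_rpow_of_nonpos (z := -m) (Real.rpow_pos_of_pos ht1 s) hle
            (by linarith)
          gcongr
        _ = M * c * ε ^ (-m - 1) * (m * s * t ^ (-(s * m) - 1) + ‖y‖ * t ^ (-(s * m) - 1)) := by
          have a1 : (t ^ s) ^ (-m - 1) * t ^ (s - 1) = t ^ (-(s * m) - 1) := by
            rw [← Real.rpow_mul ht0, ← Real.rpow_add ht1]; ring_nf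
          have a2 : (t ^ s) ^ (-m) = t ^ (-(s * m) - 1) * t := by
            rw [← Real.rpow_mul ht0, ← Real.rpow_add_one ht1.ne']; ring_nf
          have a3 : ‖y‖ = ε * t := by rw [ht]; field_simp
          rw [a1, a2, a3]; ring
        _ ≤ M * c * ε ^ (-m - 1) * (m * s * t ^ (-(s * m) - 1) + R * t ^ (-(s * m) - 1)) := by
          gcongr
        _ = _ := by simp only [A]; ring
    calc _ ≤ (A * (ε ^ (-m - 1) * t ^ (-(s * m) - 1))) ^ p := by gcongr
      _ = _ := by
        rw [Real.mul_rpow hA.le (by positivity), Real.mul_rpow (x := ε ^ (-m - 1)) (by positivity) (by positivity),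
          ← Real.rpow_mul hε.le, hmp, ← Real.rpow_mul ht0]
        have e : (-(s * m) - 1) * p = -((n - p) / (p - 1)) - n := by
          rw [hs, hm]; field_simp; ring
        rw [e, ht, Real.div_rpow hy0.le hε.le]
        congr 1
        rw [mul_div_assoc', mul_comm, mul_div_assoc, ← Real.rpow_sub hε, mul_comm]
        congr 2; ring

lemma bw_radial {n : ℕ} (hn : 0 < n) (a ε R : ℝ) (hε : 0 < ε) (hεR : ε ≤ R) :
    Integrable (fun x : EuclideanSpace ℝ (Fin n) =>
      (Set.Ioc ε R).indicator (fun r : ℝ => r ^ (a - n)) ‖x‖) ∧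
    ∫ x : EuclideanSpace ℝ (Fin n), (Set.Ioc ε R).indicator (fun r : ℝ => r ^ (a - n)) ‖x‖ =
      n * (volume.real (Metric.ball (0 : EuclideanSpace ℝ (Fin n)) 1) *
        ∫ r in ε..R, r ^ (a - 1)) := by
  have : Nonempty (Fin n) := ⟨⟨0, hn⟩⟩
  have hfun : ∀ r : ℝ, r ^ (n - 1) • (Set.Ioc ε R).indicator (fun r : ℝ => r ^ (a - n)) r
      = (Set.Ioc ε R).indicator (fun r : ℝ => r ^ (a - 1)) r := by
    intro r
    by_cases hr : r ∈ Set.Ioc ε R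
    · have hr0 : 0 < r := hε.trans hr.1
      simp only [Set.indicator_of_mem hr, smul_eq_mul]
      rw [← Real.rpow_natCast, ← Real.rpow_add hr0, Nat.cast_sub (by omega)]
      congr 1; push_cast; ring
    · simp [Set.indicator_of_notMem hr]
  have hint : IntegrableOn (fun r : ℝ => r ^ (a - 1)) (Set.Ioc ε R) := by
    rw [← intervalIntegrable_iff_integrableOn_Ioc_of_le hεR]
    apply intervalIntegral.intervalIntegrable_rpow
    right
    rw [Set.uIcc_of_le hεR]
    intro h; linarith [h.1]
  constructor
  · rw [integrable_fun_norm_addHaar]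
    simp only [finrank_euclideanSpace, Fintype.card_fin, hfun]
    exact ((integrable_indicator_iff measurableSet_Ioc).2 hint).integrableOn
  · rw [integral_fun_norm_addHaar]
    simp only [finrank_euclideanSpace, Fintype.card_fin, hfun, nsmul_eq_mul, smul_eq_mul]
    rw [setIntegral_indicator measurableSet_Ioc, intervalIntegral.integral_of_le hεR,
      Set.inter_eq_right.2 (show Set.Ioc ε R ⊆ Set.Ioi 0 from fun r hr => hε.trans hr.1)]

lemma bw_int {n : ℕ} (p : ℝ) (hp1 : 1 < p) (hpn : p < n)
    (c : ℝ) (hc : 0 < c) (η : EuclideanSpace ℝ (Fin n) → ℝ) (hη : ContDiff ℝ (⊤ : ℕ∞) η)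
    (hηcpt : HasCompactSupport η) (γ : ℝ) (hγ : p < γ) :
    ∃ A > 0, ∃ R ≥ 3, ∀ ε : ℝ, 0 < ε → ε ≤ 1 →
      (∫ y, ‖y‖ ^ γ * ‖gradient (bubbleW p c η ε) y‖ ^ p) ≤
        A * (ε ^ γ + ε ^ (((n : ℝ) - p) / (p - 1)) *
          ∫ r in ε..R, r ^ (γ - ((n : ℝ) - p) / (p - 1) - 1)) := by
  obtain ⟨B, hB, R, hR, H⟩ := bw_bound p hp1 hpn c hc η hη hηcpt
  have hn : 0 < n := by
    have : (0 : ℝ) < n := by linarith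
    exact_mod_cast this
  have : Nonempty (Fin n) := ⟨⟨0, hn⟩⟩
  set τ := ((n : ℝ) - p) / (p - 1)
  set V := volume.real (Metric.ball (0 : EuclideanSpace ℝ (Fin n)) 1) with hV
  have hV0 : 0 < V := ENNReal.toReal_pos (Metric.measure_ball_pos _ _ one_pos).ne' measure_ball_lt_top.ne
  have hn0 : (1 : ℝ) ≤ n := by exact_mod_cast hn
  refine ⟨B * (n * V), by positivity, R, hR, fun ε hε hε1 => ?_⟩
  have hεR : ε ≤ R := by linarith
  obtain ⟨hi, hI⟩ := bw_radial hn (γ - τ) ε R hε hεR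
  set J := ∫ r in ε..R, r ^ (γ - τ - 1)
  have hJ : 0 ≤ J := intervalIntegral.integral_nonneg hεR
    fun r hr => Real.rpow_nonneg (hε.le.trans hr.1) _
  have hi1 : Integrable (fun x : EuclideanSpace ℝ (Fin n) =>
      (Metric.closedBall (0 : EuclideanSpace ℝ (Fin n)) ε).indicator (fun _ => (1 : ℝ)) x) := by
    rw [integrable_indicator_iff Metric.isClosed_closedBall.measurableSet]
    exact integrableOn_const measure_closedBall_lt_top.ne
  have hI1 : ∫ x : EuclideanSpace ℝ (Fin n),
      (Metric.closedBall (0 : EuclideanSpace ℝ (Fin n)) ε).indicator (fun _ => (1 : ℝ)) x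
      = ε ^ n * V := by
    rw [integral_indicator Metric.isClosed_closedBall.measurableSet, setIntegral_const,
      Measure.addHaar_real_closedBall _ _ hε.le]
    simp [hV]
  calc _ ≤ ∫ x : EuclideanSpace ℝ (Fin n), ((B * ε ^ (γ - n)) *
        (Metric.closedBall (0 : EuclideanSpace ℝ (Fin n)) ε).indicator (fun _ => (1 : ℝ)) x +
        (B * ε ^ τ) * (Set.Ioc ε R).indicator (fun r : ℝ => r ^ (γ - τ - n)) ‖x‖) := by
        apply integral_mono_of_nonneg
        · exact Filter.Eventually.of_forall fun x => by positivity
        · exact (hi1.const_mul _).add (hi.const_mul _)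
        · refine Filter.Eventually.of_forall fun x => ?_
          obtain ⟨h1, h2, h3⟩ := H ε hε hε1 x
          dsimp only
          rcases le_or_gt ‖x‖ ε with hx | hx
          · rw [Set.indicator_of_mem (by simpa using hx),
              Set.indicator_of_notMem (fun h => absurd h.1 (not_lt.2 hx))]
            calc _ ≤ ε ^ γ * (B * ε ^ (-(n : ℝ))) := by
                  gcongr
                  · linarith
                  · exact h2 hx
              _ = _ := by rw [sub_eq_add_neg, Real.rpow_add hε]; ring
          · have hx0 : 0 < ‖x‖ := hε.trans hx
            rw [Set.indicator_of_notMem (by simpa using hx)]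
            rcases le_or_gt ‖x‖ R with hxR | hxR
            · rw [Set.indicator_of_mem (show ‖x‖ ∈ Set.Ioc ε R from ⟨hx, hxR⟩)]
              calc _ ≤ ‖x‖ ^ γ * (B * (ε ^ τ * ‖x‖ ^ (-τ - n))) := by
                    gcongr
                    exact h3 hx hxR
                _ = _ := by
                  rw [show γ - τ - n = γ + (-τ - n) by ring, Real.rpow_add hx0]; ring
            · rw [Set.indicator_of_notMem (fun h => absurd h.2 (not_le.2 hxR)), h1 hxR]
              simp [Real.zero_rpow (by linarith : p ≠ 0)]
    _ = (B * ε ^ (γ - n)) * (ε ^ n * V) + (B * ε ^ τ) * (n * (V * J)) := by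
        rw [integral_add (hi1.const_mul _) (hi.const_mul _), integral_const_mul,
          integral_const_mul, hI, hI1]
    _ = B * (1 * V) * ε ^ γ + B * (n * V) * (ε ^ τ * J) := by
        have : ε ^ γ = ε ^ (γ - n) * ε ^ n := by
          rw [← Real.rpow_natCast, ← Real.rpow_add hε]; ring_nf
        rw [this]; ring
    _ ≤ B * (n * V) * ε ^ γ + B * (n * V) * (ε ^ τ * J) := by gcongr
    _ = _ := by ring

/-- Decay estimates for `∫ |y|^γ |∇w_ε|^p dy` when `γ > p`. -/
theorem bubble_weighted_gradient_estimates {n : ℕ} (p : ℝ) (hp1 : 1 < p) (hpn : p < n)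
    (c : ℝ) (hc : 0 < c)
    (η : EuclideanSpace ℝ (Fin n) → ℝ) (hη : ContDiff ℝ (⊤ : ℕ∞) η)
    (hηcpt : HasCompactSupport η) (hη1 : ∀ᶠ x in nhds 0, η x = 1)
    (γ : ℝ) (hγ : p < γ) :
    ∃ C > 0, ∃ ε₀ > 0, ∀ ε ∈ Set.Ioo (0 : ℝ) ε₀,
      (γ < ((n : ℝ) - p) / (p - 1) →
        (∫ y, ‖y‖ ^ γ * ‖gradient (bubbleW p c η ε) y‖ ^ p) ≤ C * ε ^ γ) ∧
      (γ = ((n : ℝ) - p) / (p - 1) →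
        (∫ y, ‖y‖ ^ γ * ‖gradient (bubbleW p c η ε) y‖ ^ p) ≤ C * ε ^ γ * |Real.log ε|) ∧
      (((n : ℝ) - p) / (p - 1) < γ →
        (∫ y, ‖y‖ ^ γ * ‖gradient (bubbleW p c η ε) y‖ ^ p)
          ≤ C * ε ^ (((n : ℝ) - p) / (p - 1))) := by
  obtain ⟨A, hA, R, hR, H⟩ := bw_int p hp1 hpn c hc η hη hηcpt γ hγ
  set τ := ((n : ℝ) - p) / (p - 1)
  have hR0 : 0 < R := by linarith
  have hrp : γ ≠ τ → ∀ ε : ℝ, 0 < ε → ε ≤ 1 →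
      ∫ r in ε..R, r ^ (γ - τ - 1) = (R ^ (γ - τ) - ε ^ (γ - τ)) / (γ - τ) := by
    intro hne ε hε hε1
    rw [integral_rpow]
    · simp
    · right
      refine ⟨fun h => hne (by linarith), ?_⟩
      rw [Set.uIcc_of_le (by linarith)]
      intro h; linarith [h.1]
  rcases lt_trichotomy γ τ with hlt | heq | hgt
  · have hd : 0 < τ - γ := by linarith
    refine ⟨A * (1 + 1 / (τ - γ)), by positivity, 1, one_pos, fun ε hε =>
      ⟨fun _ => ?_, fun h => absurd h hlt.ne, fun h => absurd h hlt.not_gt⟩⟩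
    have hε0 := hε.1
    refine (H ε hε.1 hε.2.le).trans ?_
    rw [hrp hlt.ne ε hε.1 hε.2.le, mul_assoc]
    gcongr
    have e1 : (R ^ (γ - τ) - ε ^ (γ - τ)) / (γ - τ) = (ε ^ (γ - τ) - R ^ (γ - τ)) / (τ - γ) := by
      rw [← neg_sub τ γ, ← neg_sub (ε ^ _), neg_div_neg_eq, neg_sub]
    have e2 : ε ^ γ = ε ^ τ * ε ^ (γ - τ) := by rw [← Real.rpow_add hε.1]; ring_nf
    have e3 : (ε ^ (γ - τ) - R ^ (γ - τ)) / (τ - γ) ≤ ε ^ (γ - τ) / (τ - γ) := by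
      gcongr
      linarith [Real.rpow_nonneg hR0.le (γ - τ)]
    rw [e1]
    calc _ ≤ ε ^ γ + ε ^ τ * (ε ^ (γ - τ) / (τ - γ)) := by gcongr
      _ = _ := by rw [e2]; field_simp
  · refine ⟨A * 3, by positivity, 1 / R, by positivity, fun ε hε =>
      ⟨fun h => absurd h heq.not_lt, fun _ => ?_, fun h => absurd h heq.not_gt⟩⟩
    have hε0 := hε.1
    have hεR : ε * R < 1 := by have := hε.2; rwa [lt_div_iff₀ hR0] at this
    have hε1 : ε ≤ 1 := by nlinarith
    refine (H ε hε.1 hε1).trans ?_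
    have e1 : ∫ r in ε..R, r ^ (γ - τ - 1) = Real.log R - Real.log ε := by
      rw [heq, sub_self, zero_sub]
      simp only [Real.rpow_neg_one]
      rw [integral_inv_of_pos hε0 hR0, Real.log_div hR0.ne' hε0.ne']
    have e2 : Real.log ε + Real.log R < 0 := by
      rw [← Real.log_mul hε0.ne' hR0.ne']
      exact Real.log_neg (by positivity) hεR
    have e3 : 1 ≤ Real.log R := by
      rw [Real.le_log_iff_exp_le hR0]
      linarith [Real.exp_one_lt_d9]
    rw [e1, ← heq, abs_of_neg (by linarith)]
    have : 0 < ε ^ γ := by positivity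
    calc _ = A * ε ^ γ * (1 + (Real.log R - Real.log ε)) := by ring
      _ ≤ A * ε ^ γ * (3 * -Real.log ε) := by gcongr; linarith
      _ = _ := by ring
  · have hd : 0 < γ - τ := by linarith
    refine ⟨A * (1 + R ^ (γ - τ) / (γ - τ)), by positivity, 1, one_pos, fun ε hε =>
      ⟨fun h => absurd h hgt.not_gt, fun h => absurd h hgt.ne', fun _ => ?_⟩⟩
    have hε0 := hε.1
    refine (H ε hε.1 hε.2.le).trans ?_
    rw [hrp hgt.ne' ε hε.1 hε.2.le, mul_assoc]
    gcongr
    have e2 : ε ^ γ ≤ ε ^ τ := Real.rpow_le_rpow_of_exponent_ge hε0 hε.2.le hgt.le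
    have e3 : (R ^ (γ - τ) - ε ^ (γ - τ)) / (γ - τ) ≤ R ^ (γ - τ) / (γ - τ) := by
      gcongr
      linarith [Real.rpow_nonneg hε0.le (γ - τ)]
    calc _ ≤ ε ^ τ + ε ^ τ * (R ^ (γ - τ) / (γ - τ)) := by gcongr
      _ = _ := by ring
end
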